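/- Exact value of the Hilbert-transform-type integral of χ at the origin: for all h, d, ε > 0, the Cauchy principal value PV∫_ℝ χ(p)/p dp exists and equals 2h·log((d+ε)/ε) + (2h+d+ε)·log((2h+d+ε)/(d+ε)). In particular, for d = h and ε = e^{−1/h} this value equals 2 − (h+e^{−1/h})·log(h+e^{−1/h}) + (3h+e^{−1/h})·log(3h+e^{−1/h}). -/

import Mathlib

open MeasureTheory Filter

/-- The piecewise-linear destabilizing perturbation `χ_{h,d,ε}`:
`χ(p) = hp/ε` for `|p| ≤ ε`, `χ(p) = h·sgn(p)` for `ε ≤ |p| ≤ d+ε`,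
`χ(p) = sgn(p)(h+d/2+ε/2) − p/2` for `d+ε ≤ |p| ≤ 2h+d+ε`, and `χ(p) = 0` beyond. -/
noncomputable def chi (h d ε : ℝ) (p : ℝ) : ℝ :=
  if |p| ≤ ε then h * p / ε
  else if |p| ≤ d + ε then h * Real.sign p
  else if |p| ≤ 2 * h + d + ε then Real.sign p * (h + d / 2 + ε / 2) - p / 2
  else 0

theorem setIntegral_lt_abs_of_even {f : ℝ → ℝ} (hf : ∀ x, f (-x) = f x) {η : ℝ} (hη : 0 ≤ η) :
    ∫ x in {x : ℝ | η < |x|}, f x = 2 * ∫ x in Set.Ioi η, f x := by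
  have hS : MeasurableSet {x : ℝ | η < |x|} := measurableSet_lt measurable_const measurable_norm
  have hcomp : ({x : ℝ | η < |x|}.indicator f) = fun x => (Set.Ioi η).indicator f |x| := by
    ext x
    have habs : f |x| = f x := by rcases abs_choice x with h | h <;> simp [h, hf]
    simp [Set.indicator_apply, habs]
  rw [← integral_indicator hS, hcomp, integral_comp_abs, setIntegral_indicator measurableSet_Ioi,
    Set.inter_eq_right.mpr (Set.Ioi_subset_Ioi hη)]

theorem chi_neg (h d ε p : ℝ) : chi h d ε (-p) = -chi h d ε p := by
  unfold chi
  rw [abs_neg, Real.sign_neg]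
  split_ifs <;> ring

theorem chi_eq_zero_of_lt {h d ε p : ℝ} (hh : 0 < h) (hd : 0 < d) (hp : 2 * h + d + ε < |p|) :
    chi h d ε p = 0 := by
  simp only [chi]
  rw [if_neg (by linarith), if_neg (by linarith), if_neg (by linarith)]

theorem chi_div_self_of_le {h d ε p : ℝ} (hp : 0 < p) (hpε : p ≤ ε) :
    chi h d ε p / p = h / ε := by
  have : ε ≠ 0 := by linarith
  simp only [chi, abs_of_pos hp]
  rw [if_pos hpε]
  field_simp

theorem chi_div_self_of_mem_plateau {h d ε p : ℝ} (hp : 0 < p) (hεp : ε < p) (hpd : p ≤ d + ε) :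
    chi h d ε p / p = h * p⁻¹ := by
  simp only [chi, abs_of_pos hp, Real.sign_of_pos hp]
  rw [if_neg (by linarith), if_pos hpd, mul_one, div_eq_mul_inv]

theorem chi_div_self_of_mem_ramp {h d ε p : ℝ} (hd : 0 < d) (hp : 0 < p) (hdp : d + ε < p)
    (hpR : p ≤ 2 * h + d + ε) :
    chi h d ε p / p = (2 * h + d + ε) / 2 * p⁻¹ - 1 / 2 := by
  simp only [chi, abs_of_pos hp, Real.sign_of_pos hp]
  rw [if_neg (by linarith), if_neg (by linarith), if_pos hpR]
  field_simp

theorem integral_Ioi_chi_div_self {h d ε η : ℝ} (hh : 0 < h) (hd : 0 < d) (hη : 0 < η)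
    (hηε : η ≤ ε) :
    ∫ p in Set.Ioi η, chi h d ε p / p =
      h * Real.log ((d + ε) / ε)
        + (2 * h + d + ε) / 2 * Real.log ((2 * h + d + ε) / (d + ε)) - h / ε * η := by
  have hε : 0 < ε := hη.trans_le hηε
  have inv_integrable {a b : ℝ} (ha : 0 < a) (hb : 0 < b) (c : ℝ) :
      IntervalIntegrable (fun p : ℝ => c * p⁻¹) volume a b :=
    (intervalIntegrable_inv_iff.mpr
      (Or.inr (Set.notMem_uIcc_of_lt ha hb))).const_mul c
  have core : Set.EqOn (fun _ => h / ε) (fun p => chi h d ε p / p) (Set.uIoc η ε) := by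
    rw [Set.uIoc_of_le hηε]
    exact fun p hp => (chi_div_self_of_le (hη.trans hp.1) hp.2).symm
  have plateau : Set.EqOn (fun p => h * p⁻¹) (fun p => chi h d ε p / p)
      (Set.uIoc ε (d + ε)) := by
    rw [Set.uIoc_of_le (by linarith)]
    exact fun p hp => (chi_div_self_of_mem_plateau (hε.trans hp.1) hp.1 hp.2).symm
  have ramp : Set.EqOn (fun p => (2 * h + d + ε) / 2 * p⁻¹ - 1 / 2) (fun p => chi h d ε p / p)
      (Set.uIoc (d + ε) (2 * h + d + ε)) := by
    rw [Set.uIoc_of_le (by linarith)]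
    exact fun p hp =>
      (chi_div_self_of_mem_ramp hd (by linarith [hp.1]) hp.1 hp.2).symm
  have ramp_integrable := inv_integrable (a := d + ε) (b := 2 * h + d + ε) (by linarith)
    (by linarith) ((2 * h + d + ε) / 2)
  have core_chi := (intervalIntegrable_congr core).mp (intervalIntegrable_const (μ := volume))
  have plateau_chi :=
    (intervalIntegrable_congr plateau).mp (inv_integrable hε (by linarith) h)
  have ramp_chi :=
    (intervalIntegrable_congr ramp).mp (ramp_integrable.sub intervalIntegrable_const)
  have truncate : ∫ p in Set.Ioi η, chi h d ε p / p =
      ∫ p in η..(2 * h + d + ε), chi h d ε p / p := by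
    rw [intervalIntegral.integral_of_le (by linarith)]
    refine setIntegral_eq_of_subset_of_forall_sdiff_eq_zero measurableSet_Ioi
      Set.Ioc_subset_Ioi_self fun p hp => ?_
    have hpR : 2 * h + d + ε < p := not_le.mp fun hle => hp.2 ⟨hp.1, hle⟩
    rw [chi_eq_zero_of_lt hh hd (hpR.trans_le (le_abs_self p)), zero_div]
  rw [truncate, ← intervalIntegral.integral_add_adjacent_intervals core_chi
      (plateau_chi.trans ramp_chi),
    ← intervalIntegral.integral_add_adjacent_intervals plateau_chi ramp_chi,
    ← intervalIntegral.integral_congr_ae (ae_of_all _ core),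
    ← intervalIntegral.integral_congr_ae (ae_of_all _ plateau),
    ← intervalIntegral.integral_congr_ae (ae_of_all _ ramp),
    intervalIntegral.integral_sub ramp_integrable intervalIntegrable_const,
    intervalIntegral.integral_const_mul, intervalIntegral.integral_const_mul,
    integral_inv_of_pos hε (by linarith), integral_inv_of_pos (by linarith) (by linarith),
    intervalIntegral.integral_const, intervalIntegral.integral_const]
  simp only [smul_eq_mul]
  field_simp
  ring

/-- Exact value of the Hilbert-transform-type principal value integral of `χ` at the
origin, and its evaluation for `d = h`, `ε = e^{−1/h}`. -/
theorem chi_pv_at_origin (h d ε : ℝ) (hh : 0 < h) (hd : 0 < d) (hε : 0 < ε) :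
    Tendsto (fun η : ℝ => ∫ p in {p : ℝ | η < |p|}, chi h d ε p / p)
      (nhdsWithin 0 (Set.Ioi 0))
      (nhds (2 * h * Real.log ((d + ε) / ε)
        + (2 * h + d + ε) * Real.log ((2 * h + d + ε) / (d + ε)))) ∧
    (d = h ∧ ε = Real.exp (-1 / h) →
      2 * h * Real.log ((d + ε) / ε)
        + (2 * h + d + ε) * Real.log ((2 * h + d + ε) / (d + ε))
      = 2 - (h + Real.exp (-1 / h)) * Real.log (h + Real.exp (-1 / h))
          + (3 * h + Real.exp (-1 / h)) * Real.log (3 * h + Real.exp (-1 / h))) := by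
  constructor
  · have hlim : Tendsto (fun η : ℝ => 2 * (h * Real.log ((d + ε) / ε)
        + (2 * h + d + ε) / 2 * Real.log ((2 * h + d + ε) / (d + ε)) - h / ε * η))
        (nhdsWithin 0 (Set.Ioi 0))
        (nhds (2 * h * Real.log ((d + ε) / ε)
          + (2 * h + d + ε) * Real.log ((2 * h + d + ε) / (d + ε)))) := by
      refine tendsto_nhdsWithin_of_tendsto_nhds (Continuous.tendsto' (by fun_prop) _ _ ?_)
      ring
    refine hlim.congr' ?_
    filter_upwards [Ioc_mem_nhdsGT hε] with η hη
    rw [setIntegral_lt_abs_of_even (fun p => by rw [chi_neg, neg_div_neg_eq]) hη.1.le,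
      integral_Ioi_chi_div_self hh hd hη.1 hη.2]
  · rintro ⟨rfl, rfl⟩
    have he := Real.exp_pos (-1 / d)
    rw [Real.log_div (by positivity) he.ne', Real.log_div (by positivity) (by positivity),
      Real.log_exp, show 2 * d + d = 3 * d by ring]
    field_simp
    ring
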